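/- On the normalized Hochschild chain complex of a unital associative ℂ-algebra A, Connes' operator B graded-commutes with the Lie-derivative action of any normalized d-cochain D: regarding B as an operator of degree −1 and L_D as an operator of degree d−1 (placing C_n(A) in degree −n), one has B ∘ L_D − (−1)^{d−1} L_D ∘ B = 0 as maps C_n(A) → C_{n−d+2}(A) for all n. In particular, taking D = m₀ the multiplication of A (so d = 2 and L_{m₀} = b_H is the Hochschild boundary), B anticommutes with b_H: B b_H + b_H B = 0. -/

import Mathlib

open scoped TensorProduct

noncomputable section

variable (A : Type) [Ring A] [Algebra ℂ A]

/-- `Ā = A/ℂ·1`. -/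
abbrev Abar := A ⧸ (Submodule.span ℂ {(1 : A)})

/-- The normalized Hochschild chain complex `C_n(A) = A ⊗ Ā^{⊗n}`. -/
abbrev HChain (n : ℕ) := A ⊗[ℂ] (⨂[ℂ]^n (Abar A))

/-- The elementary chain `a_0 ⊗ ā_1 ⊗ ⋯ ⊗ ā_n ∈ C_n(A)` attached to a tuple
`(a_0, …, a_n)` of elements of `A`. -/
def elem (n : ℕ) (a : Fin (n + 1) → A) : HChain A n :=
  a 0 ⊗ₜ[ℂ] (PiTensorProduct.tprod ℂ fun i : Fin n =>
    (Submodule.Quotient.mk (a i.succ) : Abar A))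

/-- `B` is Connes' (Rinehart's) operator: the family of linear maps
`B : C_n(A) → C_{n+1}(A)` determined on elementary tensors by
`B(a_0 ⊗ ⋯ ⊗ a_n) = Σ_{j=0}^n (−1)^{jn} 1 ⊗ a_j ⊗ ⋯ ⊗ a_n ⊗ a_0 ⊗ ⋯ ⊗ a_{j−1}`. -/
def IsConnesB (Bmap : ∀ n : ℕ, HChain A n →ₗ[ℂ] HChain A (n + 1)) : Prop :=
  ∀ (n : ℕ) (a : Fin (n + 1) → A),
    Bmap n (elem A n a)
      = ∑ j : Fin (n + 1), ((-1 : ℂ) ^ ((j : ℕ) * n)) •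
          elem A (n + 1) (Fin.cons 1 fun i : Fin (n + 1) => a (j + i))

/-- `L` is the Lie-derivative action `L_D : C_n(A) → C_{n−d+1}(A)` of a `d`-cochain
`D : A^d → A` (`L n m _ : C_n(A) → C_m(A)` is defined whenever `n + 1 = m + d`, i.e.
`m = n − d + 1 ≥ 0`), determined on elementary tensors by
`L_D(a_0 ⊗ ⋯ ⊗ a_n) =
   Σ_{j=n−d+1}^{n} (−1)^{n(j+1)} D(a_{j+1}, …, a_n, a_0, …, a_{d+j−n−1}) ⊗ a_{d+j−n} ⊗ ⋯ ⊗ a_j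
 + Σ_{i=0}^{n−d} (−1)^{(d−1)(i+1)} a_0 ⊗ ⋯ ⊗ a_i ⊗ D(a_{i+1}, …, a_{i+d}) ⊗ ⋯ ⊗ a_n`
(in the first sum `j = m + p` with `p = 0, …, d−1`, so that `d + j − n = p + 1`). -/
def IsLieAction (dd : ℕ) (D : MultilinearMap ℂ (fun _ : Fin dd => A) A)
    (L : ∀ n m : ℕ, n + 1 = m + dd → HChain A n →ₗ[ℂ] HChain A m) : Prop :=
  ∀ (n m : ℕ) (h : n + 1 = m + dd) (a : Fin (n + 1) → A),
    L n m h (elem A n a)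
      = (∑ p : Fin dd, ((-1 : ℂ) ^ (n * (m + (p : ℕ) + 1))) •
          elem A m (fun r : Fin (m + 1) =>
            if (r : ℕ) = 0 then
              D (fun s : Fin dd =>
                if hs : (s : ℕ) < dd - 1 - (p : ℕ) then
                  a ⟨m + 1 + (p : ℕ) + (s : ℕ), by have := p.2; have := s.2; omega⟩
                else a ⟨(s : ℕ) + (p : ℕ) + 1 - dd, by have := p.2; have := s.2; omega⟩)
            else a ⟨(p : ℕ) + (r : ℕ), by have := p.2; have := r.2; omega⟩))
        + ∑ i : Fin m, ((-1 : ℂ) ^ ((dd - 1) * ((i : ℕ) + 1))) •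
            elem A m (fun r : Fin (m + 1) =>
              if hr : (r : ℕ) ≤ (i : ℕ) then a ⟨(r : ℕ), by have := i.2; have := r.2; omega⟩
              else if (r : ℕ) = (i : ℕ) + 1 then
                D (fun s : Fin dd =>
                  a ⟨(i : ℕ) + 1 + (s : ℕ), by have := i.2; have := s.2; omega⟩)
              else a ⟨(r : ℕ) + dd - 1, by have := r.2; omega⟩)

variable {A}

/-- Linear maps out of `C_n(A)` agreeing on elementary chains are equal. -/
lemma hchain_hom_ext {n : ℕ} {M : Type*} [AddCommGroup M] [Module ℂ M]
    {f g : HChain A n →ₗ[ℂ] M} (hfg : ∀ a, f (elem A n a) = g (elem A n a)) : f = g := by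
  refine TensorProduct.ext (LinearMap.ext fun x =>
    PiTensorProduct.ext (MultilinearMap.ext fun v => ?_))
  choose w hw using fun i => Submodule.Quotient.mk_surjective _ (v i)
  have key := hfg (Fin.cons x w)
  simpa [elem, hw] using key

/-- The elementary chain `g 0 ⊗ ⋯ ⊗ g n`. -/
def seqElem (n : ℕ) (g : ℤ → A) : HChain A n :=
  elem A n fun r => g (r : ℕ)

lemma seqElem_congr {n : ℕ} {f g : ℤ → A} (h : ∀ x : ℤ, 0 ≤ x → x ≤ n → f x = g x) :
    seqElem n f = seqElem n g :=
  congrArg (elem A n) (funext fun r => h _ (by omega) (by omega))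

lemma seqElem_eq_zero {n : ℕ} {g : ℤ → A} (hg : g 0 = 0) : seqElem n g = 0 := by
  simp [seqElem, elem, hg]

lemma exists_elem_eq_seqElem {n : ℕ} (a : Fin (n + 1) → A) :
    ∃ α : ℤ → A, Function.Periodic α ((n : ℤ) + 1) ∧ elem A n a = seqElem n α := by
  have pos : (0 : ℤ) < (n : ℤ) + 1 := by omega
  refine ⟨fun z => a ⟨(z % ((n : ℤ) + 1)).toNat, ?_⟩, fun z => ?_,
    congrArg (elem A n) (funext fun r => ?_)⟩
  · have := Int.emod_nonneg z pos.ne'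
    have := Int.emod_lt_of_pos z pos
    omega
  · simp
  · congr 1
    ext
    have := Int.emod_eq_of_lt (a := ((r : ℕ) : ℤ)) (b := (n : ℤ) + 1) (by omega) (by omega)
    simp [this]

lemma Function.Periodic.congr_of_shift {X : Type*} {n : ℕ} {α : ℤ → X}
    (hα : Function.Periodic α ((n : ℤ) + 1)) {x y : ℤ}
    (h : x = y ∨ x = y + (n + 1) ∨ y = x + (n + 1)) : α x = α y := by
  obtain rfl | rfl | rfl := h
  exacts [rfl, hα y, (hα x).symm]

lemma sum_range_periodic_add {M : Type*} [AddCommGroup M] {N : ℕ} {f : ℤ → M}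
    (hf : Function.Periodic f (N : ℤ)) (c : ℤ) :
    ∑ j ∈ Finset.range N, f (j + c) = ∑ j ∈ Finset.range N, f j := by
  have step (c : ℤ) : ∑ j ∈ Finset.range N, f (j + (c + 1)) = ∑ j ∈ Finset.range N, f (j + c) := by
    have h₁ := Finset.sum_range_succ (fun j : ℕ => f (j + c)) N
    rw [Finset.sum_range_succ'] at h₁
    have h₂ : f ((N : ℤ) + c) = f (((0 : ℕ) : ℤ) + c) := by rw [add_comm, hf]; simp
    rw [h₂] at h₁
    rw [← add_right_cancel h₁]
    exact Finset.sum_congr rfl fun j _ => congrArg f (by push_cast; ring)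
  induction c using Int.induction_on with
  | zero => simp
  | succ k ih => rw [step, ih]
  | pred k ih => rw [← ih, ← step, sub_add_cancel]

lemma sum_range_periodic_sub {M : Type*} [AddCommGroup M] {N : ℕ} {f : ℤ → M}
    (hf : Function.Periodic f (N : ℤ)) (c : ℤ) :
    ∑ j ∈ Finset.range N, f (c - j) = ∑ j ∈ Finset.range N, f j := by
  rw [← Finset.sum_range_reflect, ← sum_range_periodic_add hf (c + 1 - N)]
  refine Finset.sum_congr rfl fun j hj => congrArg f ?_
  have := Finset.mem_range.1 hj
  omega

lemma neg_one_zpow_eq_of_even_sub {x y : ℤ} (h : Even (x - y)) : (-1 : ℂ) ^ x = (-1) ^ y := by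
  obtain ⟨k, hk⟩ := h
  obtain rfl : x = y + 2 * k := by omega
  rw [zpow_add₀ (by simp), (even_two_mul k).neg_one_zpow, mul_one]

lemma neg_one_zpow_mul_periodic (n : ℕ) :
    Function.Periodic (fun j : ℤ => (-1 : ℂ) ^ (j * n)) ((n : ℤ) + 1) := fun j => by
  refine neg_one_zpow_eq_of_even_sub ?_
  rw [show (j + ((n : ℤ) + 1)) * n - j * n = n * (n + 1) by ring]
  exact Int.even_mul_succ_self n

/-- The elementary chain `1 ⊗ β 0 ⊗ ⋯ ⊗ β (n - 1)`. -/
def unitElem (n : ℕ) (β : ℤ → A) : HChain A n :=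
  seqElem n fun x => if x = 0 then 1 else β (x - 1)

lemma elem_cons_one {n : ℕ} (β : ℤ → A) :
    elem A (n + 1) (Fin.cons 1 fun i : Fin (n + 1) => β (i : ℕ)) = unitElem (n + 1) β := by
  rw [unitElem, seqElem]
  congr 1
  funext r
  refine Fin.cases ?_ (fun i => ?_) r
  · simp
  · have : ((i : ℕ) : ℤ) + 1 ≠ 0 := by omega
    simp [this]

lemma unitElem_congr {n : ℕ} {β γ : ℤ → A} (h : ∀ x : ℤ, 0 ≤ x → x < n → β x = γ x) :
    unitElem n β = unitElem n γ := by
  refine seqElem_congr fun x h₀ h₁ => ?_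
  split_ifs with hx
  · rfl
  · exact h _ (by omega) (by omega)

lemma IsConnesB.apply_periodic {Bmap : ∀ n : ℕ, HChain A n →ₗ[ℂ] HChain A (n + 1)}
    (hB : IsConnesB A Bmap) {n : ℕ} {α : ℤ → A} (hα : Function.Periodic α ((n : ℤ) + 1)) :
    Bmap n (seqElem n α) = ∑ j ∈ Finset.range (n + 1),
      (-1 : ℂ) ^ ((j : ℤ) * n) • unitElem (n + 1) fun x => α (j + x) := by
  rw [seqElem, hB, Finset.sum_range]
  refine Finset.sum_congr rfl fun j _ => ?_
  rw [← elem_cons_one]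
  refine congrArg₂ (· • ·) ?_
    (congrArg (fun f => elem A (n + 1) (Fin.cons 1 f)) (funext fun i => ?_))
  · rw [← zpow_natCast, Nat.cast_mul]
  · refine hα.congr_of_shift ?_
    rw [Fin.val_add_eq_ite]
    split_ifs <;> omega

lemma connesB_rotation_periodic {m : ℕ} {α : ℤ → A} (hα : Function.Periodic α ((m : ℤ) + 1)) :
    Function.Periodic (fun j : ℤ => (-1 : ℂ) ^ (j * m) • unitElem (m + 1) fun x => α (j + x))
      ((m + 1 : ℕ) : ℤ) := fun j => by
  push_cast
  exact congrArg₂ (· • ·) (neg_one_zpow_mul_periodic m j)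
    (unitElem_congr fun x _ _ => hα.congr_of_shift (by omega))

lemma IsConnesB.apply_emod {Bmap : ∀ n : ℕ, HChain A n →ₗ[ℂ] HChain A (n + 1)}
    (hB : IsConnesB A Bmap) {n : ℕ} (g : ℤ → A) (c : ℤ) :
    Bmap n (seqElem n g) = ∑ q ∈ Finset.range (n + 1),
      (-1 : ℂ) ^ ((c - q) * n) • unitElem (n + 1) fun x => g ((c - q + x) % ((n : ℤ) + 1)) := by
  have hα : Function.Periodic (fun x => g (x % ((n : ℤ) + 1))) ((n : ℤ) + 1) := fun x => by simp
  have hg : seqElem n g = seqElem n fun x => g (x % ((n : ℤ) + 1)) :=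
    seqElem_congr fun x h₀ h₁ => by rw [Int.emod_eq_of_lt h₀ (by omega)]
  rw [hg, hB.apply_periodic hα]
  exact (sum_range_periodic_sub (connesB_rotation_periodic hα) c).symm

variable {dd : ℕ} (D : MultilinearMap ℂ (fun _ : Fin dd => A) A)

/-- The signed chain `1 ⊗ α j ⊗ ⋯ ⊗ α (j + q - 1) ⊗ D(α (j + q), …) ⊗ α (j + q + dd) ⊗ ⋯`. -/
def insertion (n m : ℕ) (α : ℤ → A) (j : ℤ) (q : ℕ) : HChain A m :=
  (-1 : ℂ) ^ (j * n + ((dd : ℤ) - 1) * q) • unitElem m fun x =>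
    if x < q then α (j + x) else if x = q then D (fun s => α (j + q + (s : ℕ)))
    else α (j + x + dd - 1)

lemma insertion_periodic {n m : ℕ} {α : ℤ → A} (hα : Function.Periodic α ((n : ℤ) + 1)) (q : ℕ) :
    Function.Periodic (fun j => insertion D n m α j q) ((n + 1 : ℕ) : ℤ) := fun j => by
  push_cast
  unfold insertion
  refine congrArg₂ (· • ·) ?_ (unitElem_congr fun x _ _ => ?_)
  · rw [zpow_add₀ (by simp), zpow_add₀ (by simp)]
    exact congrArg (· * _) (neg_one_zpow_mul_periodic n j)
  · split_ifs
    · exact hα.congr_of_shift (by omega)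
    · exact congrArg D (funext fun s => hα.congr_of_shift (by omega))
    · exact hα.congr_of_shift (by omega)

variable {D} {L : ∀ n m : ℕ, n + 1 = m + dd → HChain A n →ₗ[ℂ] HChain A m}

lemma IsLieAction.apply_seqElem (hL : IsLieAction A dd D L) (hd : 1 ≤ dd) {n m : ℕ}
    (h : n + 1 = m + dd) (α : ℤ → A) :
    L n m h (seqElem n α)
      = (∑ p ∈ Finset.range dd, (-1 : ℂ) ^ ((n : ℤ) * (m + p + 1)) •
          seqElem m fun x => if x = 0 then
              D (fun s => if (s : ℕ) + p + 1 < dd then α (m + 1 + p + (s : ℕ))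
                else α ((s : ℕ) + p + 1 - dd))
            else α (p + x))
        + ∑ i ∈ Finset.range m, (-1 : ℂ) ^ (((dd : ℤ) - 1) * (i + 1)) •
          seqElem m fun x => if x ≤ i then α x
            else if x = i + 1 then D (fun s => α (i + 1 + (s : ℕ)))
            else α (x + dd - 1) := by
  rw [seqElem, hL, Finset.sum_range, Finset.sum_range]
  congr 1
  · refine Finset.sum_congr rfl fun p _ => congrArg₂ (· • ·) ?_
      (congrArg (elem A m) (funext fun r => ?_))
    · rw [← zpow_natCast]; push_cast; rfl
    · dsimp only
      split_ifs
      · refine congrArg D (funext fun s => ?_)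
        split_ifs
        · push_cast; rfl
        · omega
        · omega
        · exact congrArg α (by omega)
      · omega
      · omega
      · push_cast; rfl
  · refine Finset.sum_congr rfl fun i _ => congrArg₂ (· • ·) ?_
      (congrArg (elem A m) (funext fun r => ?_))
    · rw [← zpow_natCast]; push_cast [Nat.cast_sub hd]; rfl
    · dsimp only
      split_ifs
      any_goals omega
      · rfl
      · push_cast; rfl
      · exact congrArg α (by omega)

lemma IsLieAction.connesB_apply (hL : IsLieAction A dd D L) (hd : 1 ≤ dd)
    {Bmap : ∀ n : ℕ, HChain A n →ₗ[ℂ] HChain A (n + 1)}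
    (hB : IsConnesB A Bmap) {n m : ℕ} (h : n + 1 = m + dd)
    {α : ℤ → A} (hα : Function.Periodic α ((n : ℤ) + 1)) :
    Bmap m (L n m h (seqElem n α)) = ∑ j ∈ Finset.range (n + 1), ∑ q ∈ Finset.range (m + 1),
      insertion D n (m + 1) α j q := by
  have hn : (n : ℤ) = m + dd - 1 := by omega
  have reindex : ∑ j ∈ Finset.range (n + 1), ∑ q ∈ Finset.range (m + 1),
        insertion D n (m + 1) α j q
      = ∑ k ∈ Finset.range (m + dd), ∑ q ∈ Finset.range (m + 1),
          insertion D n (m + 1) α (k + (1 - q)) q := by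
    rw [← h, Finset.sum_comm, Finset.sum_comm (s := Finset.range (n + 1))]
    exact Finset.sum_congr rfl fun q _ =>
      (sum_range_periodic_add (insertion_periodic D hα q) (1 - q)).symm
  have emod_cases (x : ℤ) (h₁ : -(m + 1) ≤ x) (h₂ : x < 2 * (m + 1)) :
      (x % ((m : ℤ) + 1) = x ∧ 0 ≤ x ∧ x ≤ m) ∨ (x % ((m : ℤ) + 1) = x + (m + 1) ∧ x < 0) ∨
        (x % ((m : ℤ) + 1) = x - (m + 1) ∧ m < x) := by
    rcases lt_or_ge x 0 with h₃ | h₃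
    · refine .inr (.inl ⟨?_, h₃⟩)
      rw [← Int.add_emod_right, Int.emod_eq_of_lt (by omega) (by omega)]
    · rcases le_or_gt x m with h₄ | h₄
      · exact .inl ⟨Int.emod_eq_of_lt h₃ (by omega), h₃, h₄⟩
      · refine .inr (.inr ⟨?_, h₄⟩)
        rw [← Int.sub_emod_right, Int.emod_eq_of_lt (by omega) (by omega)]
  rw [reindex, hL.apply_seqElem hd, map_add, map_sum, map_sum,
    Finset.sum_range_add (fun k : ℕ => ∑ q ∈ Finset.range (m + 1),
      insertion D n (m + 1) α (k + (1 - q)) q), add_comm (∑ p ∈ Finset.range dd, _)]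
  congr 1
  · refine Finset.sum_congr rfl fun k hk => ?_
    have hk := Finset.mem_range.1 hk
    rw [map_smul, hB.apply_emod _ (k + 1), Finset.smul_sum]
    refine Finset.sum_congr rfl fun q hq => ?_
    have hq := Finset.mem_range.1 hq
    rw [smul_smul, ← zpow_add₀ (by simp)]
    refine congrArg₂ (· • ·) (congrArg _ (by rw [hn]; ring)) (unitElem_congr fun x h₀ h₁ => ?_)
    push_cast at h₁
    rcases emod_cases (k + 1 - q + x) (by omega) (by omega) with ⟨e, h₂⟩ | ⟨e, h₂⟩ | ⟨e, h₂⟩ <;>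
    · rw [e]
      split_ifs
      any_goals omega
      all_goals first
        | exact hα.congr_of_shift (by omega)
        | exact congrArg D (funext fun s => hα.congr_of_shift (by omega))
  · refine Finset.sum_congr rfl fun p hp => ?_
    have hp := Finset.mem_range.1 hp
    rw [map_smul, hB.apply_emod _ 0, Finset.smul_sum]
    refine Finset.sum_congr rfl fun q hq => ?_
    have hq := Finset.mem_range.1 hq
    rw [smul_smul, ← zpow_add₀ (by simp)]
    refine congrArg₂ (· • ·) (congrArg _ (by rw [hn]; push_cast; ring))
      (unitElem_congr fun x h₀ h₁ => ?_)
    push_cast at h₁ ⊢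
    rcases emod_cases (0 - q + x) (by omega) (by omega) with ⟨e, h₂⟩ | ⟨e, h₂⟩ | ⟨e, h₂⟩ <;>
    · rw [e]
      split_ifs
      any_goals omega
      all_goals first
        | exact hα.congr_of_shift (by omega)
        | refine congrArg D (funext fun s => ?_)
          split_ifs <;> exact hα.congr_of_shift (by omega)

/-- The Lie action on a chain with leading `1`. -/
lemma IsLieAction.apply_unitElem (hL : IsLieAction A dd D L) (hd : 1 ≤ dd) {n m : ℕ}
    (h : n + 1 + 1 = m + dd) (β : ℤ → A) :
    L (n + 1) m h (unitElem (n + 1) β)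
      = (∑ p ∈ Finset.range dd, (-1 : ℂ) ^ (((n : ℤ) + 1) * (m + p + 1)) •
          seqElem m fun x => if x = 0 then
              D (fun s => if (s : ℕ) + p + 1 < dd then β (m + p + (s : ℕ))
                else if (s : ℕ) + p + 1 = dd then 1 else β ((s : ℕ) + p - dd))
            else β (p + x - 1))
        + ∑ q ∈ Finset.range m, (-1 : ℂ) ^ (((dd : ℤ) - 1) * (q + 1)) •
          unitElem m fun x => if x < q then β x
            else if x = q then D (fun s => β (q + (s : ℕ)))
            else β (x + dd - 1) := by
  rw [unitElem, hL.apply_seqElem hd]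
  congr 1
  · refine Finset.sum_congr rfl fun p _ => congrArg₂ (· • ·) (by push_cast; rfl)
      (seqElem_congr fun x h₀ h₁ => ?_)
    split_ifs
    any_goals omega
    · refine congrArg D (funext fun s => ?_)
      split_ifs
      any_goals omega
      any_goals rfl
      all_goals exact congrArg β (by omega)
    · rfl
  · refine Finset.sum_congr rfl fun i _ => congrArg₂ (· • ·) rfl
      (seqElem_congr fun x h₀ h₁ => ?_)
    dsimp only
    split_ifs
    any_goals omega
    any_goals rfl
    · refine congrArg D (funext fun s => ?_)
      split_ifs
      · omega
      · exact congrArg β (by omega)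
    · exact congrArg β (by omega)

/-- `L_D ∘ B` splits into the terms in which `D` takes the inserted unit as an argument and
the insertions of `D` into cyclic words. -/
lemma IsLieAction.apply_connesB (hL : IsLieAction A dd D L) (hd : 1 ≤ dd)
    {Bmap : ∀ n : ℕ, HChain A n →ₗ[ℂ] HChain A (n + 1)}
    (hB : IsConnesB A Bmap) {n m : ℕ} (h : n + 1 + 1 = m + dd)
    {α : ℤ → A} (hα : Function.Periodic α ((n : ℤ) + 1)) :
    L (n + 1) m h (Bmap n (seqElem n α))
      = (∑ j ∈ Finset.range (n + 1), (-1 : ℂ) ^ ((j : ℤ) * n) •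
          ∑ p ∈ Finset.range dd, (-1 : ℂ) ^ (((n : ℤ) + 1) * (m + p + 1)) •
            seqElem m fun x => if x = 0 then
                D (fun s => if (s : ℕ) + p + 1 < dd then α (j + (m + p + (s : ℕ)))
                  else if (s : ℕ) + p + 1 = dd then 1 else α (j + ((s : ℕ) + p - dd)))
              else α (j + (p + x - 1)))
        + (-1 : ℂ) ^ (dd - 1) • ∑ j ∈ Finset.range (n + 1), ∑ q ∈ Finset.range m,
          insertion D n m α j q := by
  rw [hB.apply_periodic hα, map_sum, Finset.smul_sum, ← Finset.sum_add_distrib]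
  refine Finset.sum_congr rfl fun j _ => ?_
  rw [map_smul, hL.apply_unitElem hd, smul_add, Finset.smul_sum (s := Finset.range m),
    Finset.smul_sum (s := Finset.range m)]
  congr 1
  refine Finset.sum_congr rfl fun q _ => ?_
  rw [insertion, smul_smul, smul_smul, ← zpow_natCast, ← zpow_add₀ (by simp),
    ← zpow_add₀ (by simp)]
  refine congrArg₂ (· • ·) (congrArg _ (by push_cast [Nat.cast_sub hd]; ring))
    (unitElem_congr fun x _ _ => ?_)
  simp only [add_assoc, add_sub_assoc]

lemma IsLieAction.apply_connesB_of_normalized (hL : IsLieAction A dd D L) (hd : 1 ≤ dd)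
    (hD : ∀ (v : Fin dd → A) (i : Fin dd), v i = 1 → D v = 0)
    {Bmap : ∀ n : ℕ, HChain A n →ₗ[ℂ] HChain A (n + 1)}
    (hB : IsConnesB A Bmap) {n m : ℕ} (h : n + 1 + 1 = m + dd)
    {α : ℤ → A} (hα : Function.Periodic α ((n : ℤ) + 1)) :
    L (n + 1) m h (Bmap n (seqElem n α))
      = (-1 : ℂ) ^ (dd - 1) • ∑ j ∈ Finset.range (n + 1), ∑ q ∈ Finset.range m,
          insertion D n m α j q := by
  rw [hL.apply_connesB hd hB h hα, add_eq_right]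
  refine Finset.sum_eq_zero fun j _ => ?_
  rw [Finset.sum_eq_zero, smul_zero]
  intro p hp
  have hp := Finset.mem_range.1 hp
  rw [seqElem_eq_zero, smul_zero]
  rw [if_pos rfl]
  refine hD _ ⟨dd - 1 - p, by omega⟩ ?_
  rw [if_neg (by dsimp only; omega), if_pos (by dsimp only; omega)]

lemma IsLieAction.apply_connesB_of_mul {mulD : MultilinearMap ℂ (fun _ : Fin 2 => A) A}
    (hmul : ∀ v : Fin 2 → A, mulD v = v 0 * v 1)
    {b : ∀ n m : ℕ, n + 1 = m + 2 → HChain A n →ₗ[ℂ] HChain A m} (hb : IsLieAction A 2 mulD b)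
    {Bmap : ∀ n : ℕ, HChain A n →ₗ[ℂ] HChain A (n + 1)}
    (hB : IsConnesB A Bmap) {n : ℕ} {α : ℤ → A} (hα : Function.Periodic α ((n : ℤ) + 1)) :
    b (n + 1) n rfl (Bmap n (seqElem n α))
      = - ∑ j ∈ Finset.range (n + 1), ∑ q ∈ Finset.range n, insertion mulD n n α j q := by
  let T : ℤ → HChain A n := fun j => (-1 : ℂ) ^ (j * n) • seqElem n fun x => α (j + x)
  have hT : Function.Periodic T ((n + 1 : ℕ) : ℤ) := fun j => by
    push_cast
    exact congrArg₂ (· • ·) (neg_one_zpow_mul_periodic n j)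
      (seqElem_congr fun x _ _ => hα.congr_of_shift (by omega))
  have key : ∑ j ∈ Finset.range (n + 1), (T j - T (j + -1)) = 0 := by
    rw [Finset.sum_sub_distrib, sum_range_periodic_add hT, sub_self]
  have neg_unit (x : HChain A n) : (-1 : ℂ) • x = -x := neg_one_smul ℂ x
  rw [hb.apply_connesB one_le_two hB rfl hα, show 2 - 1 = 1 from rfl, pow_one, neg_unit,
    add_eq_right, ← key]
  refine Finset.sum_congr rfl fun j _ => ?_
  rw [Finset.sum_range_succ, Finset.sum_range_one, smul_add, smul_smul, smul_smul,
    ← zpow_add₀ (by simp), ← zpow_add₀ (by simp), sub_eq_add_neg, ← neg_unit (T _),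
    add_comm]
  refine congrArg₂ (· + ·) ?_ ?_
  · refine congrArg₂ (· • ·) (neg_one_zpow_eq_of_even_sub ?_) (seqElem_congr fun x _ _ => ?_)
    · obtain ⟨k, hk⟩ := Int.even_mul_succ_self ((n : ℤ) + 1)
      exact ⟨k, by push_cast; linear_combination hk⟩
    · split_ifs with hx
      · simp [hmul, hx]
      · exact congrArg α (by push_cast; ring)
  · rw [smul_smul, ← zpow_one_add₀ (by simp)]
    refine congrArg₂ (· • ·) (neg_one_zpow_eq_of_even_sub ?_) (seqElem_congr fun x _ _ => ?_)
    · obtain ⟨k, hk⟩ := Int.even_mul_succ_self (n : ℤ)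
      exact ⟨k + n, by push_cast; linear_combination hk⟩
    · split_ifs with hx
      · simpa [hmul, hx] using hα.congr_of_shift (by omega)
      · exact congrArg α (by push_cast; ring)

variable (A)

/-!
STATEMENT 8: on the normalized Hochschild chain complex of a unital associative
`ℂ`-algebra `A`, Connes' operator `B` graded-commutes with the Lie-derivative action of any
normalized `d`-cochain `D`:
`B ∘ L_D − (−1)^{d−1} L_D ∘ B = 0` as maps `C_n(A) → C_{n−d+2}(A)` for all `n`
(in degrees `n ≤ d − 2` both composites end in the zero space; in the remaining boundary
degree `n = d − 2` the claim reads `L_D ∘ B = 0`, since there `L_D` out of `C_n(A)` is the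
zero map to `C_{−1}(A) = 0`).
In particular, taking `D = m₀` the multiplication of `A` (so `d = 2` and `L_{m₀} = b_H` is
the Hochschild boundary), `B` anticommutes with `b_H`: `B b_H + b_H B = 0`.
-/
theorem connesB_graded_commutes_with_lie_action
    (Bmap : ∀ n : ℕ, HChain A n →ₗ[ℂ] HChain A (n + 1)) (hB : IsConnesB A Bmap) :
    -- `B` graded-commutes with `L_D` for every normalized `d`-cochain `D`
    (∀ (dd : ℕ) (_ : 1 ≤ dd) (D : MultilinearMap ℂ (fun _ : Fin dd => A) A),
      -- `D` is normalized: it vanishes whenever one of its arguments equals `1`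
      (∀ (v : Fin dd → A) (i : Fin dd), v i = 1 → D v = 0) →
      ∀ (L : ∀ n m : ℕ, n + 1 = m + dd → HChain A n →ₗ[ℂ] HChain A m),
        IsLieAction A dd D L →
        (∀ (n m : ℕ) (h : n + 1 = m + dd),
          Bmap m ∘ₗ L n m h
              - ((-1 : ℂ) ^ (dd - 1)) • (L (n + 1) (m + 1) (by omega) ∘ₗ Bmap n) = 0)
        ∧ (∀ (n : ℕ) (hn : n + 2 = dd), L (n + 1) 0 (by omega) ∘ₗ Bmap n = 0))
    ∧
    -- in particular `B b_H + b_H B = 0`, where `b_H = L_{m₀}`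
    (∀ (mulD : MultilinearMap ℂ (fun _ : Fin 2 => A) A),
      (∀ v : Fin 2 → A, mulD v = v 0 * v 1) →
      ∀ (bH : ∀ n m : ℕ, n + 1 = m + 2 → HChain A n →ₗ[ℂ] HChain A m),
        IsLieAction A 2 mulD bH →
        (∀ (n m : ℕ) (h : n + 1 = m + 2),
          Bmap m ∘ₗ bH n m h + bH (n + 1) (m + 1) (by omega) ∘ₗ Bmap n = 0)
        ∧ bH 1 0 rfl ∘ₗ Bmap 0 = 0) := by
  refine ⟨fun dd hd D hD L hL => ⟨fun n m h => ?_, fun n hn => ?_⟩,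
    fun mulD hmul bH hb => ⟨fun n m h => ?_, ?_⟩⟩ <;>
    refine hchain_hom_ext fun a => ?_ <;>
    obtain ⟨α, hα, ha⟩ := exists_elem_eq_seqElem a <;>
    rw [ha, LinearMap.zero_apply]
  · rw [LinearMap.sub_apply, LinearMap.comp_apply, LinearMap.smul_apply, LinearMap.comp_apply,
      hL.connesB_apply hd hB h hα, hL.apply_connesB_of_normalized hd hD hB _ hα, smul_smul,
      ← mul_pow, neg_one_mul, neg_neg, one_pow, one_smul, sub_self]
  · rw [LinearMap.comp_apply, hL.apply_connesB_of_normalized hd hD hB _ hα]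
    simp
  · obtain rfl : n = m + 1 := by omega
    rw [LinearMap.add_apply, LinearMap.comp_apply, LinearMap.comp_apply,
      hb.connesB_apply one_le_two hB h hα, hb.apply_connesB_of_mul hmul hB hα, add_neg_cancel]
  · rw [LinearMap.comp_apply, hb.apply_connesB_of_mul hmul hB hα]
    simp

end
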